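/- Let n ≥ 2 and M ⊂ ℝⁿ. There exists a separately continuous function f : ℝⁿ → ℝ whose set of discontinuity points equals M if and only if M is an F_σ set and for each i ∈ {1, …, n} the orthogonal projection of M onto the i-th coordinate hyperplane {x ∈ ℝⁿ : x_i = 0} is a first category (meager) subset of that hyperplane. -/

import Mathlib

/-- A function on `ℝⁿ` is separately continuous if it is continuous along every line
parallel to a coordinate axis. -/
def SeparatelyContinuous {n : ℕ} (f : EuclideanSpace ℝ (Fin n) → ℝ) : Prop :=
  ∀ (a : EuclideanSpace ℝ (Fin n)) (i : Fin n),
    Continuous fun t : ℝ => f (a + t • EuclideanSpace.single i (1:ℝ))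

open Set Filter Topology

/-- A map is quasi-continuous if every point is in the closure of the interior of the preimage
of any neighbourhood of its image. -/
def QuasiContinuous {X Y : Type*} [TopologicalSpace X] [TopologicalSpace Y] (g : X → Y) : Prop :=
  ∀ x, ∀ s ∈ 𝓝 (g x), x ∈ closure (interior (g ⁻¹' s))

namespace QuasiContinuous

variable {X Y Z : Type*} [TopologicalSpace X] [TopologicalSpace Y] [TopologicalSpace Z]

theorem comp_isOpenMap {g : Y → Z} (hg : QuasiContinuous g) {h : X → Y} (hc : Continuous h)
    (ho : IsOpenMap h) : QuasiContinuous (g ∘ h) := by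
  intro x s hs
  have h1 := hg (h x) s hs
  rw [preimage_comp, ← ho.preimage_interior_eq_interior_preimage hc,
    ← ho.preimage_closure_eq_closure_preimage hc]
  exact h1

theorem mem_of_subset_closure {g : X → Y} (hg : QuasiContinuous g) {D W : Set X} {C : Set Y}
    (hC : IsClosed C) (hW : IsOpen W) (hWD : W ⊆ closure D) (hD : ∀ x ∈ D, g x ∈ C) :
    ∀ x ∈ W, g x ∈ C := by
  intro x hx
  by_contra hxC
  obtain ⟨y, hyW, hy⟩ := mem_closure_iff.1 (hg x Cᶜ (hC.isOpen_compl.mem_nhds hxC)) W hW hx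
  obtain ⟨z, ⟨-, hz⟩, hzD⟩ := mem_closure_iff.1 (hWD hyW) (W ∩ interior (g ⁻¹' Cᶜ))
    (hW.inter isOpen_interior) ⟨hyW, hy⟩
  exact interior_subset hz (hD z hzD)

theorem isMeagre_setOf_not_continuousAt {E : Type*} [PseudoMetricSpace E] {g : X → E}
    (hg : QuasiContinuous g) : IsMeagre {x | ¬ ContinuousAt g x} := by
  let U : ℕ → Set X := fun k =>
    ⋃ y : E, interior (g ⁻¹' Metric.ball y (1 / ((k : ℝ) + 1)))
  have hU : ∀ k, U k ∈ residual X := fun k => by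
    refine residual_of_dense_open (isOpen_iUnion fun y => isOpen_interior) fun x => ?_
    exact closure_mono (subset_iUnion _ (g x))
      (hg x _ (Metric.ball_mem_nhds _ (by positivity)))
  refine mem_of_superset (countable_iInter_mem.2 hU) fun x hx => ?_
  rw [mem_compl_iff]
  refine not_not.2 (Metric.continuousAt_iff'.2 fun ε hε => ?_)
  obtain ⟨k, hk⟩ := exists_nat_one_div_lt (half_pos hε)
  obtain ⟨y, hy⟩ := mem_iUnion.1 (mem_iInter.1 hx k)
  filter_upwards [mem_interior_iff_mem_nhds.1 hy] with z hz
  have h1 : dist (g z) y < 1 / ((k : ℝ) + 1) := hz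
  have h2 := Metric.mem_ball.1 (mem_preimage.1 (interior_subset hy))
  linarith [dist_triangle_right (g z) (g x) y]

end QuasiContinuous

section Product

variable {X : Type*} [TopologicalSpace X] {f : X → ℝ → ℝ}

theorem quasiContinuous_uncurry [BaireSpace X] (hf : ∀ x, Continuous (f x))
    (hq : ∀ t, QuasiContinuous fun x => f x t) :
    QuasiContinuous fun p : X × ℝ => f p.1 p.2 := by
  rintro ⟨x₀, t₀⟩ S hS
  obtain ⟨ε, hε, hεS⟩ := Metric.nhds_basis_closedBall.mem_iff.1 hS
  refine mem_closure_iff.2 fun O hO hxO => ?_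
  obtain ⟨U, I, hU, hI, hxU, htI, hUI⟩ := isOpen_prod_iff.1 hO x₀ t₀ hxO
  set V : Set X := U ∩ interior ((fun x => f x t₀) ⁻¹' Metric.ball (f x₀ t₀) (ε / 2)) with hVdef
  have hVo : IsOpen V := hU.inter isOpen_interior
  have hVne : V.Nonempty :=
    mem_closure_iff.1 (hq t₀ x₀ _ (Metric.ball_mem_nhds _ (half_pos hε))) U hU hxU
  let A : ℕ → Set X := fun k =>
    {x | x ∈ V ∧ ∀ s ∈ Metric.ball t₀ (1 / ((k : ℝ) + 1)), dist (f x s) (f x t₀) ≤ ε / 2}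
  have hVA : V ⊆ ⋃ k, A k := fun x hx => by
    obtain ⟨δ, hδ, h⟩ := Metric.continuous_iff.1 (hf x) t₀ (ε / 2) (half_pos hε)
    obtain ⟨k, hk⟩ := exists_nat_one_div_lt hδ
    exact mem_iUnion.2 ⟨k, hx, fun s hs => (h s (lt_trans hs hk)).le⟩
  obtain ⟨k, hk⟩ : ∃ k, ¬ IsNowhereDense (A k) := by
    by_contra! h
    exact not_isMeagre_of_isOpen hVo hVne
      ((isMeagre_iUnion fun k => (h k).isMeagre).mono hVA)
  obtain ⟨z, hz⟩ := nonempty_iff_ne_empty.2 hk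
  obtain ⟨w, hwi, hwA⟩ := mem_closure_iff.1 (interior_subset hz) _ isOpen_interior hz
  set W := V ∩ interior (closure (A k))
  have hWo : IsOpen W := hVo.inter isOpen_interior
  set J := Metric.ball t₀ (1 / ((k : ℝ) + 1))
  have ht₀ : t₀ ∈ J := Metric.mem_ball_self (by positivity)
  have key : ∀ s ∈ J, ∀ x ∈ W, f x s ∈ Metric.closedBall (f x₀ t₀) ε := fun s hs =>
    (hq s).mem_of_subset_closure Metric.isClosed_closedBall hWo
      (fun x hx => interior_subset hx.2) fun x hx => by
        have h1 := hx.2 s hs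
        have h2 := Metric.mem_ball.1 (mem_preimage.1 (interior_subset hx.1.2))
        exact (dist_triangle _ (f x t₀) _).trans (by linarith)
  refine ⟨(w, t₀), hUI ⟨hwA.1.1, htI⟩, ?_⟩
  have hsub : W ×ˢ J ⊆ (fun p : X × ℝ => f p.1 p.2) ⁻¹' S := fun p hp =>
    hεS (key p.2 hp.2 p.1 hp.1)
  exact interior_maximal hsub (hWo.prod Metric.isOpen_ball) ⟨⟨hwA.1, hwi⟩, ht₀⟩

theorem isMeagre_setOf_exists_not_continuousAt_uncurry (hf : ∀ x, Continuous (f x))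
    (hq : ∀ t, QuasiContinuous fun x => f x t)
    (hd : ∀ s t, QuasiContinuous fun x => f x s - f x t) :
    IsMeagre {x | ∃ t, ¬ ContinuousAt (fun p : X × ℝ => f p.1 p.2) (x, t)} := by
  let A : ℚ → ℚ → ℕ → Set X := fun a b k =>
    {x | ∀ s ∈ Ioo (a : ℝ) b, ∀ t ∈ Ioo (a : ℝ) b, |f x s - f x t| ≤ 1 / ((k : ℝ) + 1)}
  have hA : ∀ a b k, interior (closure (A a b k)) ⊆ A a b k := fun a b k x hx s hs t ht => by
    have := (hd s t).mem_of_subset_closure (Metric.isClosed_closedBall (x := (0 : ℝ))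
      (ε := 1 / ((k : ℝ) + 1))) isOpen_interior interior_subset
      (fun y (hy : y ∈ A a b k) => by simpa using hy s hs t ht) x hx
    simpa using this
  have hB : ∀ a b k, IsMeagre (A a b k \ interior (closure (A a b k))) := fun a b k => by
    refine IsNowhereDense.isMeagre (IsNowhereDense.mono (s := frontier (closure (A a b k))) ?_ ?_)
    · rw [isClosed_closure.frontier_eq]
      exact sdiff_subset_sdiff_left subset_closure
    · exact isClosed_frontier.isNowhereDense_iff.2 (interior_frontier isClosed_closure)
  have hbad := (isMeagre_iUnion fun a => isMeagre_iUnion fun b => isMeagre_iUnion fun k =>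
    hB a b k).union (isMeagre_iUnion fun q : ℚ => (hq q).isMeagre_setOf_not_continuousAt)
  refine hbad.mono ?_
  rintro x ⟨t, ht⟩
  by_contra hx
  simp only [mem_union, mem_iUnion, not_or, not_exists] at hx
  obtain ⟨hx1, hx2⟩ := hx
  refine ht (Metric.continuousAt_iff'.2 fun ε hε => ?_)
  obtain ⟨k, hk⟩ := exists_nat_one_div_lt (show (0 : ℝ) < ε / 4 by positivity)
  obtain ⟨δ, hδ, h⟩ := Metric.continuous_iff.1 (hf x) t (1 / ((k : ℝ) + 1) / 2) (by positivity)
  obtain ⟨a, ha1, ha2⟩ := exists_rat_btwn (show t - δ < t by linarith)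
  obtain ⟨b, hb1, hb2⟩ := exists_rat_btwn (show t < t + δ by linarith)
  obtain ⟨q, hq1, hq2⟩ := exists_rat_btwn (ha2.trans hb1)
  have hxA : x ∈ A a b k := fun s hs s' hs' => by
    have h1 := h s (by rw [Real.dist_eq, abs_lt]; constructor <;> linarith [hs.1, hs.2])
    have h2 := h s' (by rw [Real.dist_eq, abs_lt]; constructor <;> linarith [hs'.1, hs'.2])
    rw [← Real.dist_eq]
    linarith [dist_triangle_right (f x s) (f x s') (f x t)]
  have hxi : x ∈ interior (closure (A a b k)) := by
    by_contra hn
    exact hx1 a b k ⟨hxA, hn⟩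
  have hcq : ContinuousAt (fun y => f y q) x := not_not.1 (hx2 q)
  rw [nhds_prod_eq]
  filter_upwards [prod_mem_prod ((Metric.continuousAt_iff'.1 hcq (ε / 4) (by positivity)).and
    (isOpen_interior.mem_nhds hxi)) (Ioo_mem_nhds ha2 hb1)]
  rintro ⟨y, s⟩ ⟨⟨hy1, hy2⟩, hs⟩
  have h1 := hA a b k hy2 s hs q ⟨hq1, hq2⟩
  have h2 := hxA q ⟨hq1, hq2⟩ t ⟨ha2, hb1⟩
  rw [← Real.dist_eq] at h1 h2
  have h3 := dist_triangle4 (f y s) (f y q) (f x q) (f x t)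
  dsimp only at hy1 ⊢
  linarith

end Product

section Pi

theorem continuous_update_insertNth {n : ℕ} {f : (Fin (n + 1) → ℝ) → ℝ}
    (hf : ∀ a i, Continuous fun t => f (Function.update a i t)) (i : Fin (n + 1)) (t : ℝ)
    (a : Fin n → ℝ) (j : Fin n) :
    Continuous fun s => f (i.insertNth t (Function.update a j s)) := by
  simp_rw [Fin.insertNth_update]
  exact hf _ _

theorem continuous_insertNth_left {n : ℕ} {f : (Fin (n + 1) → ℝ) → ℝ}
    (hf : ∀ a i, Continuous fun t => f (Function.update a i t)) (i : Fin (n + 1))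
    (x : Fin n → ℝ) : Continuous fun t => f (i.insertNth t x) := by
  simpa only [Fin.update_insertNth] using hf (i.insertNth 0 x) i

theorem isOpenMap_removeNth {n : ℕ} (i : Fin (n + 1)) :
    IsOpenMap fun x : Fin (n + 1) → ℝ => (i.removeNth x, x i) :=
  IsOpenMap.of_sections fun x => ⟨fun p => i.insertNth p.2 p.1,
    (continuous_snd.finInsertNth i continuous_fst).continuousAt,
    by simp, fun p => by simp⟩

theorem continuous_removeNth {n : ℕ} (i : Fin (n + 1)) :
    Continuous fun x : Fin (n + 1) → ℝ => (i.removeNth x : Fin n → ℝ) :=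
  continuous_pi fun j => continuous_apply (i.succAbove j)

/-- A function on `ℝⁿ` that is continuous in each variable is quasi-continuous. -/
theorem quasiContinuous_of_continuous_update : ∀ {n : ℕ} {f : (Fin n → ℝ) → ℝ},
    (∀ a i, Continuous fun t => f (Function.update a i t)) → QuasiContinuous f
  | 0, f, _ => fun x s hs => by
    have : f ⁻¹' s = univ := eq_univ_of_forall fun y => by
      rw [mem_preimage, Subsingleton.elim y x]
      exact mem_of_mem_nhds hs
    simp [this]
  | n + 1, f, hf => by
    have h := quasiContinuous_uncurry (f := fun x t => f ((0 : Fin (n + 1)).insertNth t x))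
      (continuous_insertNth_left hf 0)
      fun t => quasiContinuous_of_continuous_update (continuous_update_insertNth hf 0 t)
    have h2 := h.comp_isOpenMap ((continuous_removeNth (0 : Fin (n + 1))).prodMk
      (continuous_apply (0 : Fin (n + 1)))) (isOpenMap_removeNth 0)
    simpa only [Function.comp_def, Fin.insertNth_self_removeNth] using h2

theorem isMeagre_setOf_exists_not_continuousAt_insertNth {n : ℕ} {f : (Fin (n + 1) → ℝ) → ℝ}
    (hf : ∀ a i, Continuous fun t => f (Function.update a i t)) (i : Fin (n + 1)) :
    IsMeagre {x : Fin n → ℝ | ∃ t, ¬ ContinuousAt f (i.insertNth t x)} := by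
  refine (isMeagre_setOf_exists_not_continuousAt_uncurry
    (f := fun x t => f (i.insertNth t x)) (continuous_insertNth_left hf i)
    (fun t => quasiContinuous_of_continuous_update (continuous_update_insertNth hf i t))
    fun s t => quasiContinuous_of_continuous_update fun a j =>
      (continuous_update_insertNth hf i s a j).sub
        (continuous_update_insertNth hf i t a j)).mono ?_
  rintro x ⟨t, ht⟩
  refine ⟨t, fun h => ht ?_⟩
  have h2 : ContinuousAt (fun y : Fin (n + 1) → ℝ => (i.removeNth y, y i)) (i.insertNth t x) :=
    ((continuous_removeNth i).prodMk (continuous_apply i)).continuousAt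
  have h3 := ContinuousAt.comp_of_eq h h2 (by simp)
  simpa only [Function.comp_def, Fin.insertNth_self_removeNth] using h3

end Pi

section Construction

/-- Any dense set contains a sequence approximating every point of a given closed set `K` whose
range is closed outside `K`. -/
theorem exists_sequence_accumulating {X : Type*} [MetricSpace X]
    [SecondCountableTopology X] {K U : Set X} (hK : IsClosed K) (hne : K.Nonempty)
    (hU : Dense U) : ∃ p : ℕ → X, (∀ n, p n ∈ U) ∧ K ⊆ closure (range p) ∧
      closure (range p) ⊆ range p ∪ K := by
  have := hne.to_subtype
  let q : ℕ → K := fun n => TopologicalSpace.denseSeq K n.unpair.1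
  choose p hpU hp using fun n : ℕ =>
    hU.exists_dist_lt (q n : X) (show (0 : ℝ) < 1 / ((n : ℝ) + 1) by positivity)
  refine ⟨p, hpU, fun x hx => Metric.mem_closure_iff.2 fun ε hε => ?_, fun x hx => ?_⟩
  · obtain ⟨i, hi⟩ := Metric.dense_iff.1 (TopologicalSpace.denseRange_denseSeq K) ⟨x, hx⟩ (ε / 2)
      (half_pos hε)
    obtain ⟨hi, j, rfl⟩ := hi
    obtain ⟨m, hm⟩ := exists_nat_one_div_lt (half_pos hε)
    refine ⟨p (Nat.pair j m), mem_range_self _, ?_⟩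
    have h1 := hp (Nat.pair j m)
    have h2 : (q (Nat.pair j m)) = TopologicalSpace.denseSeq K j := by simp [q]
    rw [h2] at h1
    have h3 : 1 / ((Nat.pair j m : ℝ) + 1) ≤ 1 / ((m : ℝ) + 1) := by
      gcongr
      exact Nat.right_le_pair j m
    have h4 : dist (TopologicalSpace.denseSeq K j : X) x < ε / 2 := hi
    rw [dist_comm] at h4
    linarith [dist_triangle x (TopologicalSpace.denseSeq K j : X) (p (Nat.pair j m))]
  · by_contra hn
    rw [mem_union, not_or] at hn
    obtain ⟨δ, hδ, hδK⟩ := Metric.isOpen_iff.1 hK.isOpen_compl x hn.2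
    obtain ⟨m, hm⟩ := exists_nat_one_div_lt (half_pos hδ)
    have hfin : (p '' {n | n < m}).Finite := (finite_lt_nat m).image p
    have hO : IsOpen (Metric.ball x (δ / 2) ∩ (p '' {n | n < m})ᶜ) :=
      Metric.isOpen_ball.inter hfin.isClosed.isOpen_compl
    obtain ⟨-, ⟨hy, hy2⟩, n, rfl⟩ := mem_closure_iff.1 hx _ hO
      ⟨Metric.mem_ball_self (half_pos hδ), fun h => hn.1 (image_subset_range _ _ h)⟩
    have hnm : m ≤ n := not_lt.1 fun h => hy2 (mem_image_of_mem p h)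
    refine hδK ?_ (q n).2
    have h3 : 1 / ((n : ℝ) + 1) ≤ 1 / ((m : ℝ) + 1) := by gcongr
    have h1 := hp n
    have h4 : dist (p n) x < δ / 2 := hy
    rw [Metric.mem_ball]
    linarith [dist_triangle (q n : X) (p n) x]

theorem exists_bump {X : Type*} [MetricSpace X] [SecondCountableTopology X]
    {K C : Set X} (hK : IsClosed K) (hC : IsClosed C) (hKC : K ⊆ C) (hd : Dense Cᶜ) :
    ∃ f : X → ℝ, (∀ x, 0 ≤ f x) ∧ (∀ x, f x ≤ 1) ∧ (∀ x ∈ C, f x = 0) ∧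
      (∀ x ∉ K, ContinuousAt f x) ∧ ∀ x ∈ K, ∃ᶠ y in 𝓝 x, f y = 1 := by
  rcases K.eq_empty_or_nonempty with rfl | hne
  · exact ⟨fun _ => 0, by simp, by simp, by simp, fun _ _ => continuousAt_const, by simp⟩
  obtain ⟨p, hpC, hKp, hpK⟩ := exists_sequence_accumulating hK hne hd
  have hCne := hne.mono hKC
  refine ⟨fun x => Metric.infDist x C / (Metric.infDist x C + Metric.infDist x (range p)),
    fun x => ?_, fun x => ?_, fun x hx => ?_, fun x hx => ?_, fun x hx => ?_⟩
  · exact div_nonneg Metric.infDist_nonneg (add_nonneg Metric.infDist_nonneg Metric.infDist_nonneg)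
  · exact div_le_one_of_le₀ (le_add_of_nonneg_right Metric.infDist_nonneg)
      (add_nonneg Metric.infDist_nonneg Metric.infDist_nonneg)
  · simp [Metric.infDist_zero_of_mem hx]
  · refine (Metric.continuous_infDist_pt C).continuousAt.div
      ((Metric.continuous_infDist_pt C).add (Metric.continuous_infDist_pt _)).continuousAt ?_
    intro h0
    rw [add_eq_zero_iff_of_nonneg Metric.infDist_nonneg Metric.infDist_nonneg] at h0
    have hxC : x ∈ C := (hC.mem_iff_infDist_zero hCne).2 h0.1
    rcases hpK ((Metric.mem_closure_iff_infDist_zero (range_nonempty p)).2 h0.2) with ⟨n, rfl⟩ | h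
    · exact hpC n hxC
    · exact hx h
  · refine (mem_closure_iff_frequently.1 (hKp hx)).mono ?_
    rintro - ⟨n, rfl⟩
    have h1 : Metric.infDist (p n) C ≠ 0 := fun h =>
      hpC n ((hC.mem_iff_infDist_zero hCne).2 h)
    simp [Metric.infDist_zero_of_mem (mem_range_self n), h1]

theorem not_continuousAt_tsum {X : Type*} [TopologicalSpace X] {f : ℕ → X → ℝ} {x : X} {k : ℕ}
    (h0 : ∀ k x, 0 ≤ f k x) (h1 : ∀ k x, f k x ≤ 1) (hc : ∀ j < k, ContinuousAt (f j) x)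
    (hx : f k x = 0) (hfr : ∃ᶠ y in 𝓝 x, f k y = 1) :
    ¬ ContinuousAt (fun y => ∑' k, (1 / 4 : ℝ) ^ k * f k y) x := by
  intro h
  have hgeo : Summable fun k : ℕ => (1 / 4 : ℝ) ^ k :=
    summable_geometric_of_lt_one (by norm_num) (by norm_num)
  have hle : ∀ k y, (1 / 4 : ℝ) ^ k * f k y ≤ (1 / 4 : ℝ) ^ k := fun k y =>
    mul_le_of_le_one_right (by positivity) (h1 k y)
  have hnn : ∀ k y, 0 ≤ (1 / 4 : ℝ) ^ k * f k y := fun k y =>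
    mul_nonneg (by positivity) (h0 k y)
  have hs : ∀ y, Summable fun k => (1 / 4 : ℝ) ^ k * f k y := fun y =>
    Summable.of_nonneg_of_le (fun k => hnn k y) (fun k => hle k y) hgeo
  have hsplit : ∀ y, ∑' k, (1 / 4 : ℝ) ^ k * f k y -
      ∑ j ∈ Finset.range k, (1 / 4 : ℝ) ^ j * f j y =
      (1 / 4 : ℝ) ^ k * f k y + ∑' j, (1 / 4 : ℝ) ^ (j + (k + 1)) * f (j + (k + 1)) y :=
    fun y => by
      rw [← (hs y).sum_add_tsum_nat_add (k + 1), Finset.sum_range_succ]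
      ring
  have hcont : ContinuousAt (fun y => (1 / 4 : ℝ) ^ k * f k y +
      ∑' j, (1 / 4 : ℝ) ^ (j + (k + 1)) * f (j + (k + 1)) y) x := by
    simp_rw [← hsplit]
    exact h.sub (tendsto_finsetSum _ fun j hj =>
      (hc j (Finset.mem_range.1 hj)).const_mul _)
  have hpos : (0 : ℝ) < (1 / 4) ^ k := by positivity
  have htail : ∑' j, (1 / 4 : ℝ) ^ (j + (k + 1)) * f (j + (k + 1)) x ≤ (1 / 4) ^ k / 3 := by
    refine (((summable_nat_add_iff (k + 1)).2 (hs x)).tsum_le_tsum (fun j => hle _ x)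
      ((summable_nat_add_iff (k + 1)).2 hgeo)).trans ?_
    simp_rw [pow_add]
    rw [tsum_mul_right, tsum_geometric_of_lt_one (by norm_num) (by norm_num)]
    norm_num
    linarith
  have hev := Tendsto.eventually_lt_const (u := (1 / 4 : ℝ) ^ k) (by
    simp only [hx]
    linarith) hcont
  obtain ⟨y, hy1, hy⟩ := (hfr.and_eventually hev).exists
  have : 0 ≤ ∑' j, (1 / 4 : ℝ) ^ (j + (k + 1)) * f (j + (k + 1)) y :=
    tsum_nonneg fun j => hnn _ y
  rw [hy1] at hy
  linarith

theorem continuousAt_tsum_of_forall {X : Type*} [TopologicalSpace X] {f : ℕ → X → ℝ} {x : X}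
    (h0 : ∀ k x, 0 ≤ f k x) (h1 : ∀ k x, f k x ≤ 1) (hc : ∀ k, ContinuousAt (f k) x) :
    ContinuousAt (fun y => ∑' k, (1 / 4 : ℝ) ^ k * f k y) x := by
  refine tendsto_tsum_of_dominated_convergence
    (summable_geometric_of_lt_one (r := (1 / 4 : ℝ)) (by norm_num) (by norm_num))
    (fun k => (hc k).const_mul _) (Eventually.of_forall fun y k => ?_)
  rw [Real.norm_of_nonneg (mul_nonneg (by positivity) (h0 k y))]
  exact mul_le_of_le_one_right (by positivity) (h1 k y)

end Construction

section Euclidean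

open WithLp in
theorem SeparatelyContinuous.continuous_update {n : ℕ} {f : EuclideanSpace ℝ (Fin n) → ℝ}
    (hf : SeparatelyContinuous f) (a : Fin n → ℝ) (i : Fin n) :
    Continuous fun t => f (toLp 2 (Function.update a i t)) := by
  have h : ∀ t, toLp 2 (Function.update a i t) =
      toLp 2 a + (t - a i) • EuclideanSpace.single i (1 : ℝ) := fun t => by
    ext j
    rcases eq_or_ne j i with rfl | hj <;> simp [*]
  simp_rw [h]
  exact (hf (toLp 2 a) i).comp (continuous_sub_right (a i))

/-- The orthogonal projection onto the `i`-th coordinate hyperplane. -/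
noncomputable def coordProj {n : ℕ} (i : Fin n) (x : EuclideanSpace ℝ (Fin n)) :
    {x : EuclideanSpace ℝ (Fin n) | x i = 0} :=
  ⟨x - x i • EuclideanSpace.single i (1 : ℝ), by simp⟩

theorem continuous_coordProj {n : ℕ} (i : Fin n) : Continuous (coordProj i) := by
  unfold coordProj
  fun_prop

theorem isOpenMap_coordProj {n : ℕ} (i : Fin n) : IsOpenMap (coordProj i) :=
  IsOpenMap.of_sections fun x => ⟨fun y => y + x i • EuclideanSpace.single i (1 : ℝ),
    by fun_prop, by simp [coordProj], fun y => by
      have : (y : EuclideanSpace ℝ (Fin n)) i = 0 := y.2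
      simp [coordProj, this]⟩

theorem coordProj_add_smul {n : ℕ} (i : Fin n) (x : EuclideanSpace ℝ (Fin n)) (t : ℝ) :
    coordProj i (x + t • EuclideanSpace.single i (1 : ℝ)) = coordProj i x := by
  ext1
  simp [coordProj, add_smul]

theorem preimage_val_image_eq_image_coordProj {n : ℕ} (i : Fin n)
    (M : Set (EuclideanSpace ℝ (Fin n))) :
    ((Subtype.val ⁻¹' ((fun x => x - x i • EuclideanSpace.single i (1 : ℝ)) '' M)) :
      Set {x : EuclideanSpace ℝ (Fin n) | x i = 0}) = coordProj i '' M := by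
  ext y
  simp only [mem_preimage, mem_image, coordProj, Subtype.ext_iff]

theorem SeparatelyContinuous.isMeagre_image_coordProj {n : ℕ}
    {f : EuclideanSpace ℝ (Fin n) → ℝ} (hf : SeparatelyContinuous f) (i : Fin n) :
    IsMeagre (coordProj i '' {x | ¬ ContinuousAt f x}) := by
  obtain _ | n := n
  · exact i.elim0
  have hc : Continuous fun y : {x : EuclideanSpace ℝ (Fin (n + 1)) | x i = 0} =>
      (i.removeNth (WithLp.ofLp (y : EuclideanSpace ℝ (Fin (n + 1)))) : Fin n → ℝ) :=
    (continuous_removeNth i).comp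
      ((PiLp.continuous_ofLp 2 _).comp continuous_subtype_val)
  have hs : Continuous fun x : Fin n → ℝ =>
      (WithLp.toLp 2 (i.insertNth 0 x) : EuclideanSpace ℝ (Fin (n + 1))) :=
    (PiLp.continuous_toLp 2 _).comp
      (Continuous.finInsertNth (A := fun _ => ℝ) i continuous_const continuous_id)
  have ho : IsOpenMap fun y : {x : EuclideanSpace ℝ (Fin (n + 1)) | x i = 0} =>
      (i.removeNth (WithLp.ofLp (y : EuclideanSpace ℝ (Fin (n + 1)))) : Fin n → ℝ) :=
    IsOpenMap.of_sections fun y => ⟨fun x => ⟨WithLp.toLp 2 (i.insertNth 0 x), by simp⟩,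
      (hs.subtype_mk fun x => by simp).continuousAt, by
        ext1
        have hy : (y : EuclideanSpace ℝ (Fin (n + 1))) i = 0 := y.2
        have h := Fin.insertNth_self_removeNth i
          (WithLp.ofLp (y : EuclideanSpace ℝ (Fin (n + 1))))
        rw [hy] at h
        exact congrArg (WithLp.toLp 2) h, fun x => by simp⟩
  refine ((isMeagre_setOf_exists_not_continuousAt_insertNth
    (f := fun x => f (WithLp.toLp 2 x)) hf.continuous_update i).preimage_of_isOpenMap hc ho).mono ?_
  rintro - ⟨x, hx, rfl⟩
  refine ⟨x i, fun h => hx ?_⟩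
  have heq : i.insertNth (x i) (i.removeNth (WithLp.ofLp (coordProj i x : EuclideanSpace ℝ _))) =
      WithLp.ofLp x := by
    rw [Fin.insertNth_eq_iff]
    refine ⟨rfl, funext fun j => ?_⟩
    simp [coordProj, Fin.removeNth]
  rw [heq] at h
  exact h.comp (f := WithLp.ofLp) (PiLp.continuous_ofLp 2 _).continuousAt

/-- A compact set whose coordinate projections are meagre is the discontinuity set of a separately
continuous function with values in `[0, 1]` that oscillates as much as possible there. -/
theorem exists_separatelyContinuous_of_isCompact {n : ℕ} [NeZero n]
    {K : Set (EuclideanSpace ℝ (Fin n))} (hK : IsCompact K)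
    (hm : ∀ i, IsMeagre (coordProj i '' K)) :
    ∃ f : EuclideanSpace ℝ (Fin n) → ℝ, SeparatelyContinuous f ∧ (∀ x, 0 ≤ f x) ∧
      (∀ x, f x ≤ 1) ∧ (∀ x ∈ K, f x = 0) ∧ (∀ x ∉ K, ContinuousAt f x) ∧
      ∀ x ∈ K, ∃ᶠ y in 𝓝 x, f y = 1 := by
  let C : Set (EuclideanSpace ℝ (Fin n)) := ⋃ i, coordProj i ⁻¹' (coordProj i '' K)
  have hC : IsClosed C := isClosed_iUnion_of_finite fun i =>
    (hK.image (continuous_coordProj i)).isClosed.preimage (continuous_coordProj i)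
  have hKC : K ⊆ C := fun x hx => mem_iUnion.2 ⟨0, x, hx, rfl⟩
  have hCm : IsMeagre C := isMeagre_iUnion fun i =>
    (hm i).preimage_of_isOpenMap (continuous_coordProj i) (isOpenMap_coordProj i)
  obtain ⟨f, h0, h1, hfC, hfK, hfr⟩ := exists_bump hK.isClosed hC hKC (dense_of_mem_residual hCm)
  refine ⟨f, fun a i => ?_, h0, h1, fun x hx => hfC x (hKC hx), hfK, hfr⟩
  by_cases ha : ∃ t : ℝ, a + t • EuclideanSpace.single i (1 : ℝ) ∈ K
  · obtain ⟨t, ht⟩ := ha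
    have : ∀ s : ℝ, f (a + s • EuclideanSpace.single i (1 : ℝ)) = 0 := fun s =>
      hfC _ (mem_iUnion.2 ⟨i, _, ht, by simp only [coordProj_add_smul]⟩)
    simp only [this, continuous_const]
  · push Not at ha
    exact continuous_iff_continuousAt.2 fun t =>
      (hfK _ (ha t)).comp (f := fun t : ℝ => a + t • EuclideanSpace.single i (1 : ℝ))
        (by fun_prop)

theorem exists_separatelyContinuous_of_iUnion {n : ℕ} [NeZero n]
    {K : ℕ → Set (EuclideanSpace ℝ (Fin n))} (hK : ∀ k, IsCompact (K k))
    (hm : ∀ k i, IsMeagre (coordProj i '' K k)) :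
    ∃ f : EuclideanSpace ℝ (Fin n) → ℝ, SeparatelyContinuous f ∧
      {x | ¬ ContinuousAt f x} = ⋃ k, K k := by
  choose f hsc h0 h1 hfK hc hfr using fun k =>
    exists_separatelyContinuous_of_isCompact (hK k) (hm k)
  refine ⟨fun x => ∑' k, (1 / 4 : ℝ) ^ k * f k x, fun a i => ?_, ?_⟩
  · exact continuous_iff_continuousAt.2 fun t =>
      continuousAt_tsum_of_forall (f := fun k t => f k (a + t • EuclideanSpace.single i (1 : ℝ)))
        (fun k t => h0 k _) (fun k t => h1 k _) fun k => (hsc k a i).continuousAt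
  · ext x
    constructor
    · intro hx
      by_contra hn
      exact hx (continuousAt_tsum_of_forall h0 h1 fun k =>
        hc k x fun h => hn (mem_iUnion.2 ⟨k, h⟩))
    · intro hx
      classical
      have hx := mem_iUnion.1 hx
      exact not_continuousAt_tsum h0 h1 (fun j hj => hc j x (Nat.find_min hx hj))
        (hfK _ x (Nat.find_spec hx)) (hfr _ x (Nat.find_spec hx))

end Euclidean

theorem stmt_13 (n : ℕ) (hn : 2 ≤ n) (M : Set (EuclideanSpace ℝ (Fin n))) :
    (∃ f : EuclideanSpace ℝ (Fin n) → ℝ, SeparatelyContinuous f ∧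
        {x : EuclideanSpace ℝ (Fin n) | ¬ ContinuousAt f x} = M) ↔
      ((∃ F : ℕ → Set (EuclideanSpace ℝ (Fin n)),
          (∀ m, IsClosed (F m)) ∧ M = ⋃ m, F m) ∧
        ∀ i : Fin n,
          IsMeagre
            ((Subtype.val ⁻¹'
                ((fun x => x - x i • EuclideanSpace.single i (1:ℝ)) '' M)) :
              Set {x : EuclideanSpace ℝ (Fin n) | x i = 0})) := by
  simp only [preimage_val_image_eq_image_coordProj]
  constructor
  · rintro ⟨f, hf, rfl⟩
    refine ⟨?_, fun i => hf.isMeagre_image_coordProj i⟩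
    obtain ⟨U, hU, h⟩ := (IsGδ.setOfPred_continuousAt f).eq_iInter_nat
    refine ⟨fun m => (U m)ᶜ, fun m => (hU m).isClosed_compl, ?_⟩
    rw [← compl_iInter, ← h]
    rfl
  · rintro ⟨⟨F, hF, rfl⟩, hm⟩
    have : NeZero n := ⟨by omega⟩
    have hK : ⋃ m, F m = ⋃ k : ℕ, F k.unpair.1 ∩ Metric.closedBall 0 (k.unpair.2 : ℝ) := by
      rw [iUnion_unpair fun i j => F i ∩ Metric.closedBall 0 (j : ℝ)]
      simp_rw [← inter_iUnion, Metric.iUnion_closedBall_nat, inter_univ]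
    rw [hK]
    exact exists_separatelyContinuous_of_iUnion
      (fun k => (isCompact_closedBall 0 _).inter_left (hF _))
      fun k i => (hm i).mono (image_mono (inter_subset_left.trans (subset_iUnion F _)))
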